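/- (Comparative statics of the threshold: dμ_k/dτ > 0.) Fix σ > 0 and a real constant c, and for τ ∈ (0,1) let μ_k(τ) denote the unique real solution of μ = log(τ/(1-τ)) + σ²/2 + log((1 - Φ((μ - σ²)/σ)) / Φ(μ/σ)) - c, where Φ is the standard normal cumulative distribution function. Then μ_k is strictly increasing in τ: for all τ₁, τ₂ ∈ (0,1) with τ₁ < τ₂, one has μ_k(τ₁) < μ_k(τ₂). -/

import Mathlib

open Real MeasureTheory

/-- The probability density function of the standard normal distribution. -/
noncomputable def stdNormalPDF (x : ℝ) : ℝ :=
  (Real.sqrt (2 * Real.pi))⁻¹ * Real.exp (-x ^ 2 / 2)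

/-- The cumulative distribution function of the standard normal distribution. -/
noncomputable def stdNormalCDF (x : ℝ) : ℝ :=
  ∫ t in Set.Iic x, stdNormalPDF t

theorem stdNormalPDF_eq_gaussianPDFReal :
    stdNormalPDF = ProbabilityTheory.gaussianPDFReal 0 1 := by
  ext x
  simp [stdNormalPDF, ProbabilityTheory.gaussianPDFReal]

theorem stdNormalPDF_pos (x : ℝ) : 0 < stdNormalPDF x := by
  unfold stdNormalPDF
  positivity

theorem integrable_stdNormalPDF : Integrable stdNormalPDF := by
  rw [stdNormalPDF_eq_gaussianPDFReal]
  exact ProbabilityTheory.integrable_gaussianPDFReal 0 1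

theorem integral_stdNormalPDF : ∫ x, stdNormalPDF x = 1 := by
  rw [stdNormalPDF_eq_gaussianPDFReal]
  exact ProbabilityTheory.integral_gaussianPDFReal_eq_one 0 one_ne_zero

theorem setIntegral_stdNormalPDF_pos {s : Set ℝ} (hs : volume s ≠ 0) :
    0 < ∫ x in s, stdNormalPDF x := by
  have hsupp : Function.support stdNormalPDF = Set.univ :=
    Set.eq_univ_of_forall fun x => (stdNormalPDF_pos x).ne'
  rw [setIntegral_pos_iff_support_of_nonneg_ae
    (Filter.Eventually.of_forall fun x => (stdNormalPDF_pos x).le)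
    integrable_stdNormalPDF.integrableOn, hsupp, Set.univ_inter]
  exact pos_iff_ne_zero.mpr hs

theorem stdNormalCDF_pos (x : ℝ) : 0 < stdNormalCDF x :=
  setIntegral_stdNormalPDF_pos (by simp)

theorem stdNormalCDF_lt_one (x : ℝ) : stdNormalCDF x < 1 := by
  have hpos : 0 < ∫ t in Set.Ioi x, stdNormalPDF t := setIntegral_stdNormalPDF_pos (by simp)
  have hadd := intervalIntegral.integral_Iic_add_Ioi (b := x)
    integrable_stdNormalPDF.integrableOn integrable_stdNormalPDF.integrableOn
  rw [integral_stdNormalPDF] at hadd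
  unfold stdNormalCDF
  linarith

theorem stdNormalCDF_monotone : Monotone stdNormalCDF := fun _ _ hxy =>
  setIntegral_mono_set integrable_stdNormalPDF.integrableOn
    (Filter.Eventually.of_forall fun t => (stdNormalPDF_pos t).le)
    (Set.Iic_subset_Iic.mpr hxy).eventuallyLE

theorem strictMonoOn_log_odds :
    StrictMonoOn (fun τ : ℝ => Real.log (τ / (1 - τ))) (Set.Ioo 0 1) := by
  intro a ha b hb hab
  have ha' : 0 < 1 - a := sub_pos.mpr ha.2
  have hb' : 0 < 1 - b := sub_pos.mpr hb.2
  refine Real.log_lt_log (div_pos ha.1 ha') ?_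
  rw [div_lt_div_iff₀ ha' hb']
  linarith

theorem antitone_log_tail_ratio {σ : ℝ} (hσ : 0 < σ) :
    Antitone fun μ : ℝ =>
      Real.log ((1 - stdNormalCDF ((μ - σ ^ 2) / σ)) / stdNormalCDF (μ / σ)) := by
  intro a b hab
  have htail : 0 < 1 - stdNormalCDF ((b - σ ^ 2) / σ) := sub_pos.mpr (stdNormalCDF_lt_one _)
  have htail' : 0 < 1 - stdNormalCDF ((a - σ ^ 2) / σ) := sub_pos.mpr (stdNormalCDF_lt_one _)
  refine Real.log_le_log (div_pos htail (stdNormalCDF_pos _)) ?_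
  refine div_le_div₀ htail'.le ?_ (stdNormalCDF_pos _) ?_
  · exact sub_le_sub_left (stdNormalCDF_monotone (by gcongr)) 1
  · exact stdNormalCDF_monotone (by gcongr)

/-- Comparative statics of the ability threshold: if `μ₁` and `μ₂` solve the fixed-point
equation `μ = log(τ/(1-τ)) + σ²/2 + log((1 - Φ((μ - σ²)/σ)) / Φ(μ/σ)) - c` for data cost
rates `τ₁ < τ₂` respectively, then `μ₁ < μ₂`; i.e. the threshold is strictly increasing
in the data cost rate. -/
theorem threshold_strictMono_in_cost (σ c τ₁ τ₂ μ₁ μ₂ : ℝ) (hσ : 0 < σ)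
    (hτ₁ : τ₁ ∈ Set.Ioo (0 : ℝ) 1) (hτ₂ : τ₂ ∈ Set.Ioo (0 : ℝ) 1) (hττ : τ₁ < τ₂)
    (h₁ : μ₁ = Real.log (τ₁ / (1 - τ₁)) + σ ^ 2 / 2
      + Real.log ((1 - stdNormalCDF ((μ₁ - σ ^ 2) / σ)) / stdNormalCDF (μ₁ / σ)) - c)
    (h₂ : μ₂ = Real.log (τ₂ / (1 - τ₂)) + σ ^ 2 / 2
      + Real.log ((1 - stdNormalCDF ((μ₂ - σ ^ 2) / σ)) / stdNormalCDF (μ₂ / σ)) - c) :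
    μ₁ < μ₂ := by
  by_contra! hle
  have hodds := strictMonoOn_log_odds hτ₁ hτ₂ hττ
  have htail := antitone_log_tail_ratio hσ hle
  dsimp only at hodds htail
  linarith
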